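/- Let K be a separably closed field and f ∈ K[x] a polynomial of degree d ≥ 2; assume char(K) = 0 or char(K) does not divide the local degree of any point of P^1_K. Write G := G_∞(K,f,t) and let g_∞ be the inertia topological generator corresponding to the totally ramified fixed point ∞. Then: (i) for every n ≥ 1, g_∞^{d^n} ∈ St_G(n), and for every level-n vertex v the first-level restriction of the section (g_∞^{d^n})|_v acts as a d-cycle on the immediate descendants of v; (ii) the fixed-point process of G is a martingale. -/

import Mathlib

set_option synthInstance.maxHeartbeats 1000000
set_option maxHeartbeats 2000000

open Polynomial MeasureTheory

namespace ArbGal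
/-- The projective line `P¹(K) = K ∪ {∞}`; `none` is the point at infinity. -/
abbrev P1 (K : Type*) := Option K

section PolyDyn

variable (K : Type*) [Field K]

/-- The local degree (ramification index) of the polynomial `f` at a finite point
`z`: the order of vanishing of `f(x) − f(z)` at `z`. -/
noncomputable def ldeg (f : Polynomial K) (z : K) : ℕ :=
  Polynomial.rootMultiplicity z (f - Polynomial.C (f.eval z))

/-- The self-map of `P¹(K)` induced by a polynomial (fixing `∞`). -/
def evalP (f : Polynomial K) : P1 K → P1 K
  | Option.some z => Option.some (f.eval z)
  | Option.none => Option.none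

/-- The local degree of the polynomial `f` at a point of `P¹(K)`; at `∞` it is
`deg f`, since `∞` is totally ramified. -/
noncomputable def ldegP (f : Polynomial K) : P1 K → ℕ
  | Option.some z => ldeg K f z
  | Option.none => f.natDegree

/-- The set `C_f ⊆ P¹(K)` of critical points of a polynomial. -/
def Crit (f : Polynomial K) : Set (P1 K) := {z | 2 ≤ ldegP K f z}

/-- The post-critical set `P_f = ⋃_{n ≥ 1} f^n(C_f) ⊆ P¹(K)` of a polynomial. -/
def PostCrit (f : Polynomial K) : Set (P1 K) :=
  {w | ∃ n : ℕ, 1 ≤ n ∧ ∃ c ∈ Crit K f, (evalP K f)^[n] c = w}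

/-- A set `Σ ⊆ P_f` is exceptional if `Σ = f⁻¹(Σ) \\ C_f`. -/
def IsExc (f : Polynomial K) (s : Set (P1 K)) : Prop :=
  s ⊆ PostCrit K f ∧ s = (evalP K f) ⁻¹' s \ Crit K f

/-- The maximal exceptional set `Σ_f` (the union of all exceptional sets). -/
def maxExc (f : Polynomial K) : Set (P1 K) := ⋃₀ {s | IsExc K f s}

/-- A set `Υ ⊆ P_f` is critically exceptional if
`Υ = f⁻¹(Υ) \\ ((C_f ∪ P_f) \\ Υ)`. -/
def IsCritExc (f : Polynomial K) (s : Set (P1 K)) : Prop :=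
  s ⊆ PostCrit K f ∧ s = (evalP K f) ⁻¹' s \ ((Crit K f ∪ PostCrit K f) \ s)

/-- The maximal critically exceptional set `Υ_f`. -/
def maxCritExc (f : Polynomial K) : Set (P1 K) := ⋃₀ {s | IsCritExc K f s}

/-- `Δ_f`: the set of post-critical points all of whose preimages are critical or
post-critical. -/
def Deltaf (f : Polynomial K) : Set (P1 K) :=
  {p ∈ PostCrit K f | (evalP K f) ⁻¹' {p} ⊆ Crit K f ∪ PostCrit K f}

/-- The iterate `f^n` of a polynomial, as a polynomial. -/
noncomputable def iterP (f : Polynomial K) : ℕ → Polynomial K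
  | 0 => Polynomial.X
  | n + 1 => f.comp (iterP f n)

/-- The set of local degrees `e_{f^n}(w)` over all finite backward orbits of a
finite point `z`; the orbifold multiplicity `ν_f(z)` is its least common multiple
(`∞` if it is unbounded). -/
def branchSet (f : Polynomial K) (z : K) : Set ℕ :=
  {e | ∃ n : ℕ, 1 ≤ n ∧ ∃ w : K, (iterP K f n).eval w = z ∧ ldeg K (iterP K f n) w = e}

/-- `ν_f(z) = m` (a finite value): `m` is the least common multiple of the branch
data of `f` over `z`. -/
def nuEq (f : Polynomial K) (z : K) (m : ℕ) : Prop :=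
  (∀ e ∈ branchSet K f z, e ∣ m) ∧ ∀ m' : ℕ, (∀ e ∈ branchSet K f z, e ∣ m') → m ∣ m'

/-- A polynomial of degree `≥ 2` has a euclidean (Thurston) orbifold of type
`(2,2,∞)`: the orbifold multiplicity `ν_f` equals `2` at exactly two finite points
and `1` at every other finite point (the third orbifold point being `∞`, where
`ν_f(∞) = ∞` automatically since `∞` is a totally ramified, hence super-attracting,
fixed point). -/
def HasEuclid22Inf (f : Polynomial K) : Prop :=
  ∃ p₁ p₂ : K, p₁ ≠ p₂ ∧ nuEq K f p₁ 2 ∧ nuEq K f p₂ 2 ∧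
    ∀ z : K, z ≠ p₁ → z ≠ p₂ → nuEq K f z 1

/-- Tameness: `char K = 0`, or `char K` does not divide the local degree of `f` at
any point of `P¹(K)`. -/
def TameAll (f : Polynomial K) : Prop :=
  ringChar K = 0 ∨ ∀ z : P1 K, ¬ (ringChar K ∣ ldegP K f z)

/-- Tameness at critical points: `char K = 0`, or `char K` does not divide the local
degree of `f` at any critical point of `f` (including `∞`). -/
def TameCrit (f : Polynomial K) : Prop :=
  ringChar K = 0 ∨ ∀ z ∈ Crit K f, ¬ (ringChar K ∣ ldegP K f z)

/-- `g` is a standard twisted Chebyshev polynomial of degree `d`: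
`g(x + 1/x) = x^d + ζ/x^d` for some `ζ` with `ζ^(d−1) = 1`. -/
def IsStdTwistedCheb (g : Polynomial K) (d : ℕ) : Prop :=
  ∃ ζ : K, ζ ^ (d - 1) = 1 ∧
    (Polynomial.aeval (RatFunc.X + (RatFunc.X)⁻¹) g : RatFunc K)
      = RatFunc.X ^ d + algebraMap K (RatFunc K) ζ * ((RatFunc.X)⁻¹) ^ d

/-- `f` is a twisted Chebyshev polynomial: it is linearly conjugate (over `K`) to a
standard twisted Chebyshev polynomial. -/
def IsTwistedCheb (f : Polynomial K) : Prop :=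
  ∃ g : Polynomial K, IsStdTwistedCheb K g f.natDegree ∧
    ∃ a b : K, a ≠ 0 ∧
      (Polynomial.C a * Polynomial.X + Polynomial.C b).comp f
        = g.comp (Polynomial.C a * Polynomial.X + Polynomial.C b)

/-- `g = ±T_d` where `T_d` is the `d`-th Chebyshev polynomial, i.e. the unique
polynomial with `g(x + 1/x) = ±(x^d + 1/x^d)`. -/
def IsPMCheb (g : Polynomial K) (d : ℕ) : Prop :=
  (Polynomial.aeval (RatFunc.X + (RatFunc.X)⁻¹) g : RatFunc K)
      = RatFunc.X ^ d + ((RatFunc.X)⁻¹) ^ d ∨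
  (Polynomial.aeval (RatFunc.X + (RatFunc.X)⁻¹) g : RatFunc K)
      = -(RatFunc.X ^ d + ((RatFunc.X)⁻¹) ^ d)

end PolyDyn

/-- The rational function field `K(t)`, with `t = RatFunc.X` a transcendental
element over `K`. -/
abbrev Fr (K : Type) [Field K] := RatFunc K

/-- A separable closure of `K(t)`, realized inside an algebraic closure. -/
noncomputable def Ssep (K : Type) [Field K] :
    IntermediateField (Fr K) (AlgebraicClosure (Fr K)) :=
  separableClosure (Fr K) (AlgebraicClosure (Fr K))

/-- The separable closure of `K(t)`, as a field. -/
abbrev Sf (K : Type) [Field K] := ↥(Ssep K)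

/-- The image of `t` in the separable closure of `K(t)`. -/
noncomputable def tS (K : Type) [Field K] : Sf K := algebraMap (Fr K) (Sf K) RatFunc.X

/-- A polynomial over `K`, viewed over `K(t)`. -/
noncomputable def fF (K : Type) [Field K] (f : Polynomial K) : Polynomial (Fr K) :=
  f.map (algebraMap K (Fr K))

/-- The `n`-th level `f^{-n}(t)` of the tree of preimages of `t`, inside the
separable closure of `K(t)`. -/
noncomputable def preimS (K : Type) [Field K] (f : Polynomial K) : ℕ → Set (Sf K)
  | 0 => {tS K}
  | n + 1 => {s | Polynomial.aeval s (fF K f) ∈ preimS K f n}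

/-- The field `K_∞(f,t)`, generated over `K(t)` by all the preimages
`⋃_n f^{-n}(t)`. -/
noncomputable def KinfI (K : Type) [Field K] (f : Polynomial K) :
    IntermediateField (Fr K) (Sf K) :=
  IntermediateField.adjoin (Fr K) (⋃ n, preimS K f n)

/-- The field `K_∞(f,t)` as a type. -/
abbrev Kinf (K : Type) [Field K] (f : Polynomial K) := ↥(KinfI K f)

/-- The geometric iterated Galois group `G_∞(K,f,t) = Gal(K_∞(f,t)/K(t))`,
equipped with its Krull topology. -/
abbrev Gal (K : Type) [Field K] (f : Polynomial K) := Kinf K f ≃ₐ[Fr K] Kinf K f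

/-- The Borel σ-algebra on the Galois group (for its Krull topology). -/
noncomputable instance (K : Type) [Field K] (f : Polynomial K) :
    MeasurableSpace (Gal K f) := borel _

/-- The element `t` inside `K_∞(f,t)`. -/
noncomputable def tK (K : Type) [Field K] (f : Polynomial K) : Kinf K f :=
  algebraMap (Fr K) (Kinf K f) RatFunc.X

/-- The `n`-th level of the preimage tree, inside `K_∞(f,t)`. -/
noncomputable def preimK (K : Type) [Field K] (f : Polynomial K) (n : ℕ) :
    Set (Kinf K f) := {s | (s : Sf K) ∈ preimS K f n}

/-- `σ` fixes an end of the tree of preimages `T_t`: there is an infinite rooted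
path `t = s_0, s_1, s_2, …` with `f(s_{n+1}) = s_n`, each of whose vertices is
fixed by `σ`. -/
noncomputable def FixesEndGal (K : Type) [Field K] (f : Polynomial K)
    (σ : Gal K f) : Prop :=
  ∃ s : ℕ → Kinf K f, s 0 = tK K f ∧
    (∀ n, Polynomial.aeval (s (n + 1)) (fF K f) = s n) ∧
    ∀ n, σ (s n) = s n

/-- The fixed-point process on the Galois group: `X_n(σ)` is the number of elements
of `f^{-n}(t)` fixed by `σ`. -/
noncomputable def XfixGal (K : Type) [Field K] (f : Polynomial K) (n : ℕ)
    (σ : Gal K f) : ℕ :=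
  Set.ncard {s ∈ preimK K f n | σ s = s}

/-- The fixed-point process of `G_∞(K,f,t)` is a martingale with respect to `μ`. -/
noncomputable def FPMartingaleGal (K : Type) [Field K] (f : Polynomial K)
    (μ : Measure (Gal K f)) : Prop :=
  (∀ n : ℕ, 1 ≤ n → Integrable (fun σ : Gal K f => (XfixGal K f n σ : ℝ)) μ) ∧
  ∀ n : ℕ, 1 ≤ n → ∀ t : ℕ → ℝ,
    μ {σ : Gal K f | ∀ i, 1 ≤ i → i ≤ n → (XfixGal K f i σ : ℝ) = t i} ≠ 0 →
    ∫ σ in {σ : Gal K f | ∀ i, 1 ≤ i → i ≤ n → (XfixGal K f i σ : ℝ) = t i},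
        (XfixGal K f (n + 1) σ : ℝ) ∂μ
      = t n * (μ {σ : Gal K f | ∀ i, 1 ≤ i → i ≤ n → (XfixGal K f i σ : ℝ) = t i}).toReal


/-- The element of `K(t)` cutting out the place of `K(t)` corresponding to the point
`p ∈ P¹(K)`: `t − p` for a finite point, and `1/t` for `p = ∞`. -/
noncomputable def uPt (K : Type) [Field K] (pt : P1 K) : Fr K :=
  match pt with
  | Option.some a => RatFunc.X - algebraMap K (Fr K) a
  | Option.none => (RatFunc.X)⁻¹

/-- The coordinate ring `K[t − p]` (resp. `K[1/t]`) of the affine chart of `P¹`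
adapted to the point `p`. -/
noncomputable def Rbase (K : Type) [Field K] (pt : P1 K) : Subalgebra K (Fr K) :=
  Algebra.adjoin K {uPt K pt}

/-- The ring `O_∞`: the integral closure of the coordinate ring adapted to `p`
inside `K_∞(f,t)`. -/
noncomputable def Oord (K : Type) [Field K] (f : Polynomial K) (pt : P1 K) :
    Subalgebra ↥(Rbase K pt) (Kinf K f) :=
  integralClosure ↥(Rbase K pt) (Kinf K f)

/-- `𝔓` is a prime of `O_∞` lying above the prime `(t − p)` (resp. `(1/t)` for
`p = ∞`). -/
noncomputable def IsPrimeOver (K : Type) [Field K] (f : Polynomial K) (pt : P1 K)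
    (𝔓 : Ideal ↥(Oord K f pt)) : Prop :=
  𝔓.IsPrime ∧
    Ideal.comap (algebraMap ↥(Rbase K pt) ↥(Oord K f pt)) 𝔓
      = Ideal.span {⟨uPt K pt, Algebra.self_mem_adjoin_singleton K _⟩}

/-- The inertia subgroup `I_𝔓 ≤ G_∞(K,f,t)` of a prime `𝔓` of `O_∞`: the elements
acting trivially on the residue ring `O_∞/𝔓` (such elements automatically stabilize
`𝔓`). -/
noncomputable def inertiaSet (K : Type) [Field K] (f : Polynomial K) (pt : P1 K)
    (𝔓 : Ideal ↥(Oord K f pt)) : Set (Gal K f) :=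
  {σ | ∀ x : ↥(Oord K f pt), ∃ h : σ (x : Kinf K f) ∈ Oord K f pt,
      (⟨σ (x : Kinf K f), h⟩ - x : ↥(Oord K f pt)) ∈ 𝔓}

/-- `g` is a family of inertia topological generators for `G_∞(K,f,t)`:
for each post-critical point `p`, `g p` topologically generates the inertia subgroup
of a prime above `(t − p)`; the family topologically generates `G_∞(K,f,t)`; and
(when `P_f` is finite) it admits an ordering whose product is `1`. -/
noncomputable def InertiaGenFamily (K : Type) [Field K] (f : Polynomial K)
    (g : P1 K → Gal K f) : Prop :=
  (∀ pt ∈ PostCrit K f, ∃ 𝔓 : Ideal ↥(Oord K f pt), IsPrimeOver K f pt 𝔓 ∧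
      closure ((Subgroup.zpowers (g pt) : Subgroup (Gal K f)) : Set (Gal K f))
        = inertiaSet K f pt 𝔓) ∧
  closure ((Subgroup.closure (g '' PostCrit K f) : Subgroup (Gal K f)) : Set (Gal K f))
      = Set.univ ∧
  ∀ _ : (PostCrit K f).Finite, ∃ l : List (P1 K), l.Nodup ∧
    (∀ x : P1 K, x ∈ l ↔ x ∈ PostCrit K f) ∧ (l.map g).prod = 1

/-- The polynomial `p(x) - t` is irreducible over `K(t)`. -/
theorem irreducible_map_sub_C_X {K : Type*} [Field K] (p : K[X]) (hp : 0 < p.natDegree) :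
    Irreducible (p.map (algebraMap K (RatFunc K)) - C RatFunc.X) := by
  have hirr : Irreducible (p.map (C : K →+* K[X]) - C X) := by
    have h : p.map (C : K →+* K[X]) - C X = Bivariate.swap (C p - X) := by
      simp [Bivariate.swap_C, Bivariate.swap_Y]
    rw [h, MulEquiv.irreducible_iff, ← neg_sub]
    exact (Associated.refl (X - C p)).neg_left.irreducible_iff.2 (irreducible_X_sub_C p)
  have hmap : (p.map (C : K →+* K[X]) - C X).map (algebraMap K[X] (RatFunc K)) =
      p.map (algebraMap K (RatFunc K)) - C RatFunc.X := by
    rw [Polynomial.map_sub, Polynomial.map_map, map_C, RatFunc.algebraMap_X]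
    rfl
  have hdeg : (p.map (C : K →+* K[X]) - C X).natDegree ≠ 0 := by
    rw [natDegree_sub_C, natDegree_map_eq_of_injective C_injective]
    exact hp.ne'
  rw [← hmap, ← (hirr.isPrimitive hdeg).irreducible_iff_irreducible_map_fraction_map]
  exact hirr

theorem natDegree_map_sub_C_X {K : Type*} [Field K] (p : K[X]) :
    (p.map (algebraMap K (RatFunc K)) - C RatFunc.X).natDegree = p.natDegree := by
  rw [natDegree_sub_C, natDegree_map]

theorem separable_map_sub_C_X {K : Type*} [Field K] (p : K[X]) (hp : (p.natDegree : K) ≠ 0) :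
    (p.map (algebraMap K (RatFunc K)) - C RatFunc.X).Separable := by
  have h0 : 0 < p.natDegree := Nat.pos_of_ne_zero fun h => hp (by simp [h])
  refine (separable_iff_derivative_ne_zero (irreducible_map_sub_C_X p h0)).2 ?_
  rw [derivative_sub, derivative_C, sub_zero, derivative_map]
  refine (Polynomial.map_ne_zero_iff (algebraMap K (RatFunc K)).injective).2 fun h => ?_
  have := congrArg (fun q => q.coeff (p.natDegree - 1)) h
  simp only [coeff_derivative, coeff_zero] at this
  rw [Nat.sub_add_cancel h0] at this
  have h1 : ((p.natDegree - 1 : ℕ) : K) + 1 = p.natDegree := by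
    rw [← Nat.cast_add_one, Nat.sub_add_cancel h0]
  rw [h1] at this
  rcases mul_eq_zero.1 this with h | h
  · exact h0.ne' (by rw [leadingCoeff_eq_zero.1 h, natDegree_zero])
  · exact hp h

section Tree

variable (K : Type) [Field K] (f : K[X])

instance : Algebra.IsSeparable (Fr K) (Sf K) :=
  inferInstanceAs (Algebra.IsSeparable (Fr K) (separableClosure (Fr K) (AlgebraicClosure (Fr K))))

instance : IsGalois (Fr K) (Sf K) :=
  inferInstanceAs (IsGalois (Fr K) (separableClosure (Fr K) (AlgebraicClosure (Fr K))))

instance : IsSepClosed (Sf K) :=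
  inferInstanceAs (IsSepClosed (separableClosure (Fr K) (AlgebraicClosure (Fr K))))

/-- The `n`-th iterate of `f` under composition. -/
noncomputable def iter (n : ℕ) : K[X] := f.comp^[n] X

theorem iter_succ_comp (n : ℕ) : iter K f (n + 1) = (iter K f n).comp f := by
  induction n with
  | zero => simp [iter]
  | succ n ih =>
    have h (m : ℕ) : iter K f (m + 1) = f.comp (iter K f m) := Function.iterate_succ_apply' _ _ _
    rw [h (n + 1), ih, ← comp_assoc, ← h n, ih]

theorem natDegree_iter (n : ℕ) : (iter K f n).natDegree = f.natDegree ^ n := by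
  simp [iter, natDegree_iterate_comp]

theorem mem_preimS_iff (n : ℕ) (s : Sf K) :
    s ∈ preimS K f n ↔ aeval s ((iter K f n).map (algebraMap K (Fr K))) = tS K := by
  induction n generalizing s with
  | zero => simp [preimS, iter]
  | succ n ih =>
    rw [iter_succ_comp, Polynomial.map_comp, aeval_comp]
    exact ih _

theorem mem_preimK_iff (n : ℕ) (s : Kinf K f) :
    s ∈ preimK K f n ↔ aeval s ((iter K f n).map (algebraMap K (Fr K))) = tK K f := by
  refine (mem_preimS_iff K f n s).trans ?_
  rw [show (s : Sf K) = (KinfI K f).val s from rfl, aeval_algHom_apply]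
  exact Subtype.coe_inj (b := tK K f)

theorem mem_preimK_succ_iff (n : ℕ) (s : Kinf K f) :
    s ∈ preimK K f (n + 1) ↔ aeval s (fF K f) ∈ preimK K f n := by
  rw [mem_preimK_iff, mem_preimK_iff, iter_succ_comp, Polynomial.map_comp, aeval_comp]
  rfl

instance : IsGalois (Fr K) (Kinf K f) := by
  have : Normal (Fr K) (Kinf K f) := by
    refine IntermediateField.normal_iff_forall_map_le'.2 fun σ => ?_
    rw [KinfI, IntermediateField.adjoin_map]
    refine IntermediateField.adjoin.mono _ _ _ ?_
    rintro _ ⟨x, hx, rfl⟩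
    simp only [Set.mem_iUnion] at hx ⊢
    obtain ⟨n, hn⟩ := hx
    refine ⟨n, ?_⟩
    rw [mem_preimS_iff] at hn ⊢
    rw [aeval_algHom_apply, hn]
    exact AlgEquiv.commutes _ _
  have : Algebra.IsSeparable (Fr K) (Kinf K f) :=
    Algebra.isSeparable_tower_bot_of_isSeparable (Fr K) (Kinf K f) (Sf K)
  exact ⟨⟩

variable {K f}

theorem apply_mem_preimK (σ : Gal K f) {n : ℕ} {s : Kinf K f} (hs : s ∈ preimK K f n) :
    σ s ∈ preimK K f n := by
  rw [mem_preimK_iff] at hs ⊢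
  rw [← AlgEquiv.coe_toAlgHom, aeval_algHom_apply, hs]
  exact AlgEquiv.commutes _ _

theorem natDegree_iter_ne_zero (hf : (f.natDegree : K) ≠ 0) (n : ℕ) :
    ((iter K f n).natDegree : K) ≠ 0 := by
  rw [natDegree_iter, Nat.cast_pow]
  exact pow_ne_zero _ hf

theorem preimS_eq_rootSet (hf : (f.natDegree : K) ≠ 0) (n : ℕ) : preimS K f n =
    ((iter K f n).map (algebraMap K (Fr K)) - C RatFunc.X).rootSet (Sf K) := by
  ext s
  rw [mem_preimS_iff, mem_rootSet_of_ne
    (separable_map_sub_C_X _ (natDegree_iter_ne_zero hf n)).ne_zero, map_sub, sub_eq_zero, aeval_C]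
  rfl

theorem ncard_preimS (hf : (f.natDegree : K) ≠ 0) (n : ℕ) :
    (preimS K f n).ncard = f.natDegree ^ n := by
  have hsep := separable_map_sub_C_X _ (natDegree_iter_ne_zero hf n)
  rw [preimS_eq_rootSet hf, ← Nat.card_coe_set_eq, Nat.card_eq_fintype_card,
    card_rootSet_eq_natDegree hsep (IsSepClosed.splits_codomain _ hsep), natDegree_map_sub_C_X,
    natDegree_iter]

theorem finite_preimS (hf : (f.natDegree : K) ≠ 0) (n : ℕ) : (preimS K f n).Finite := by
  rw [preimS_eq_rootSet hf]
  exact rootSet_finite _ _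

theorem image_preimK (n : ℕ) :
    (fun s : Kinf K f => (s : Sf K)) '' preimK K f n = preimS K f n := by
  ext s
  refine ⟨?_, fun hs => ?_⟩
  · rintro ⟨x, hx, rfl⟩
    exact hx
  · exact ⟨⟨s, IntermediateField.subset_adjoin _ _ (Set.mem_iUnion.2 ⟨n, hs⟩)⟩, hs, rfl⟩

theorem ncard_preimK (hf : (f.natDegree : K) ≠ 0) (n : ℕ) :
    (preimK K f n).ncard = f.natDegree ^ n := by
  rw [← ncard_preimS hf n, ← image_preimK, Set.ncard_image_of_injective _ Subtype.val_injective]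

theorem finite_preimK (hf : (f.natDegree : K) ≠ 0) (n : ℕ) : (preimK K f n).Finite := by
  refine Set.Finite.of_finite_image ?_ Subtype.val_injective.injOn
  exact (image_preimK (f := f) n) ▸ finite_preimS hf n

theorem exists_gal_apply_eq (hf : (f.natDegree : K) ≠ 0) {n : ℕ} {s s' : Kinf K f}
    (hs : s ∈ preimK K f n) (hs' : s' ∈ preimK K f n) : ∃ σ : Gal K f, σ s = s' := by
  have hn := natDegree_iter_ne_zero hf n
  have hirr := irreducible_map_sub_C_X (iter K f n)
    (Nat.pos_of_ne_zero fun h => hn (by simp [h]))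
  have h0 : ∀ x ∈ preimK K f n,
      aeval x ((iter K f n).map (algebraMap K (Fr K)) - C RatFunc.X) = 0 := fun x hx => by
    rw [map_sub, (mem_preimK_iff K f n x).1 hx, aeval_C, sub_eq_zero]
    rfl
  refine isConjRoot_iff_exists_algEquiv.1 ?_
  rw [isConjRoot_def, ← minpoly.eq_of_irreducible hirr (h0 s hs),
    ← minpoly.eq_of_irreducible hirr (h0 s' hs')]

end Tree

/-- Every prime ideal of a subring of a field is the center of a valuation. -/
theorem exists_valuationSubring_of_isPrime {B L : Type*} [CommRing B] [Field L] (ι : B →+* L)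
    (hι : Function.Injective ι) (P : Ideal B) [P.IsPrime] :
    ∃ V : ValuationSubring L, ∀ b, V.valuation (ι b) ≤ 1 ∧ (V.valuation (ι b) < 1 ↔ b ∈ P) := by
  have hu : ∀ y : P.primeCompl, IsUnit (ι y) := fun y => by
    refine isUnit_iff_ne_zero.2 fun h => y.2 ?_
    rw [(injective_iff_map_eq_zero ι).1 hι _ h]
    exact P.zero_mem
  let φ : Localization.AtPrime P →+* L := IsLocalization.lift hu
  have hφ (b : B) : φ (algebraMap B _ b) = ι b := IsLocalization.lift_eq hu b
  obtain ⟨V, hV, hloc⟩ := IsLocalRing.exists_factor_valuationRing φ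
  refine ⟨V, fun b => ?_⟩
  have hb : ι b ∈ V := hφ b ▸ hV (algebraMap B _ b)
  refine ⟨(V.valuation_le_one_iff _).2 hb, ?_⟩
  have h1 : IsUnit (algebraMap B (Localization.AtPrime P) b) ↔ b ∈ P.primeCompl :=
    IsLocalization.AtPrime.isUnit_to_map_iff _ P b
  have h2 := isUnit_map_iff (φ.codRestrict V.toSubring hV) (algebraMap B _ b)
  have h3 : φ.codRestrict V.toSubring hV (algebraMap B _ b) = (⟨ι b, hb⟩ : V) :=
    Subtype.ext (hφ b)
  rw [h3, h1] at h2
  have h4 := V.valuation_lt_one_iff ⟨ι b, hb⟩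
  rw [← not_iff_not]
  refine Iff.trans ?_ h2
  have h5 := V.valuation_eq_one_iff ⟨ι b, hb⟩
  refine Iff.trans ?_ h5.symm
  rw [not_lt]
  exact ⟨fun h => le_antisymm ((V.valuation_le_one_iff _).2 hb) h, fun h => h.ge⟩

/-- A rational expression in an element `s` outside the valuation ring lies in the maximal ideal
if and only if its denominator has larger degree than its numerator. -/
theorem valuation_div_lt_one_iff {K L Γ : Type*} [Field K] [Field L] [Algebra K L]
    [LinearOrderedCommGroupWithZero Γ] (v : Valuation L Γ) [v.IsTrivialOn K] {s : L}
    (hs : 1 < v s) {p q : K[X]} (hp : p ≠ 0) (hq : q ≠ 0) :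
    v (aeval s p / aeval s q) < 1 ↔ p.natDegree < q.natDegree := by
  rw [map_div₀, valuation_aeval_eq_valuation_X_pow_natDegree_of_one_lt_valuation_X s hs hp,
    valuation_aeval_eq_valuation_X_pow_natDegree_of_one_lt_valuation_X s hs hq,
    div_lt_one₀ (pow_pos (zero_lt_one.trans hs) _), pow_lt_pow_iff_right₀ hs]

/-- If `t = p(s)`, then every element of `K(t)(s)` is a rational expression in `s` over `K`. -/
theorem exists_eq_aeval_div_of_mem_adjoin {K L : Type*} [Field K] [Field L] [Algebra K L]
    [Algebra (RatFunc K) L] [IsScalarTower K (RatFunc K) L] {s : L} {p : K[X]}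
    (hs : aeval s p = algebraMap (RatFunc K) L RatFunc.X) {y : L}
    (hy : y ∈ IntermediateField.adjoin (RatFunc K) {s}) :
    ∃ a b : K[X], y = aeval s a / aeval s b := by
  have hle : IntermediateField.adjoin (RatFunc K) {s} ≤
      (Subfield.toIntermediateField (IntermediateField.adjoin K {s}).toSubfield fun x => by
        have hX (c : K[X]) : algebraMap (RatFunc K) L (algebraMap K[X] (RatFunc K) c) ∈
            IntermediateField.adjoin K {s} := by
          rw [← RatFunc.aeval_X_left_eq_algebraMap, ← aeval_algebraMap_apply, ← hs, ← aeval_comp]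
          exact IntermediateField.algebra_adjoin_le_adjoin K {s} (aeval_mem_adjoin_singleton K s)
        rw [← RatFunc.num_div_denom x, map_div₀]
        exact div_mem (hX _) (hX _)) := by
    rw [IntermediateField.adjoin_le_iff, Set.singleton_subset_iff]
    exact IntermediateField.mem_adjoin_simple_self K s
  exact (IntermediateField.mem_adjoin_simple_iff K y).1 (hle hy)

section Place

variable {K : Type} [Field K] {f : K[X]}

noncomputable instance (pt : P1 K) : MulSemiringAction (Gal K f) (Oord K f pt) :=
  inferInstanceAs (MulSemiringAction (Gal K f) (integralClosure (Rbase K pt) (Kinf K f)))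

/-- The local parameter `1/t` at infinity. -/
noncomputable def uInf (K : Type) [Field K] : Rbase K Option.none :=
  ⟨uPt K Option.none, Algebra.self_mem_adjoin_singleton K _⟩

theorem IsPrimeOver.algebraMap_uInf_mem {P : Ideal (Oord K f Option.none)}
    (hP : IsPrimeOver K f Option.none P) : algebraMap _ (Oord K f Option.none) (uInf K) ∈ P := by
  have : uInf K ∈ Ideal.comap (algebraMap (Rbase K Option.none) (Oord K f Option.none)) P :=
    hP.2 ▸ Ideal.mem_span_singleton_self _
  exact this

/-- Valuations centered at a prime above `1/t` see elements of `K(s)`, for `s` with `p(s) = t`,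
through their order at `s = ∞` only. -/
theorem mem_prime_iff_mem_prime {P Q : Ideal (Oord K f Option.none)} [P.IsPrime] [Q.IsPrime]
    (hP : algebraMap _ (Oord K f Option.none) (uInf K) ∈ P)
    (hQ : algebraMap _ (Oord K f Option.none) (uInf K) ∈ Q)
    {s : Kinf K f} {p : K[X]} (hs : aeval s p = tK K f) {y : Oord K f Option.none}
    (hy : (y : Kinf K f) ∈ IntermediateField.adjoin (Fr K) {s}) : y ∈ P ↔ y ∈ Q := by
  obtain ⟨a, b, hab⟩ := exists_eq_aeval_div_of_mem_adjoin hs hy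
  by_cases hy0 : (y : Kinf K f) = 0
  · have : y = 0 := Subtype.ext hy0
    simp [this]
  have ha : a ≠ 0 := by
    rintro rfl
    simp [hab] at hy0
  have hb : b ≠ 0 := by
    rintro rfl
    simp [hab] at hy0
  have key (P : Ideal (Oord K f Option.none)) [P.IsPrime]
      (hP : algebraMap _ (Oord K f Option.none) (uInf K) ∈ P) :
      y ∈ P ↔ a.natDegree < b.natDegree := by
    obtain ⟨V, hV⟩ := exists_valuationSubring_of_isPrime
      (Oord K f Option.none).val.toRingHom Subtype.val_injective P
    have hle (c : K) : V.valuation (algebraMap K (Kinf K f) c) ≤ 1 :=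
      (hV (algebraMap K (Oord K f Option.none) c)).1
    have htriv : V.valuation.IsTrivialOn K := ⟨fun c hc => by
      refine le_antisymm (hle c) ?_
      have h := hle c⁻¹
      rwa [map_inv₀, map_inv₀, inv_le_one₀] at h
      exact (Valuation.pos_iff _).2 (by simpa using hc)⟩
    have ht : 1 < V.valuation (tK K f) := by
      have h := ((hV _).2).2 hP
      have h' : V.valuation (tK K f)⁻¹ < 1 := by
        convert h using 2
        exact (map_inv₀ (algebraMap (Fr K) (Kinf K f)) RatFunc.X).symm
      rwa [map_inv₀, inv_lt_one₀] at h'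
      exact (Valuation.pos_iff _).2 (by simp [tK, RatFunc.X_ne_zero])
    have hs1 : 1 < V.valuation s := by
      by_contra hcon
      rw [not_lt, V.valuation_le_one_iff] at hcon
      refine ht.not_ge ?_
      rw [V.valuation_le_one_iff, ← hs, aeval_eq_sum_range]
      refine V.toSubring.sum_mem fun i _ => ?_
      rw [Algebra.smul_def]
      exact V.mul_mem _ _ ((V.valuation_le_one_iff _).1 (hle _)) (V.toSubring.pow_mem hcon i)
    rw [← (hV y).2, ← valuation_div_lt_one_iff V.valuation hs1 ha hb, ← hab]
    rfl
  rw [key P hP, key Q hQ]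

/-- The stabilizer of a prime above `1/t` acts trivially on its residue ring, since the latter is
purely inseparable over `K`. -/
theorem mem_inertiaSet_of_stabilizes [IsSepClosed K] {P : Ideal (Oord K f Option.none)}
    (hPprime : P.IsPrime) (hP : algebraMap _ (Oord K f Option.none) (uInf K) ∈ P) {τ : Gal K f}
    (hτ : ∀ x, x ∈ P → τ • x ∈ P) : τ ∈ inertiaSet K f Option.none P := by
  have hint : Algebra.IsIntegral K (Oord K f Option.none ⧸ P) := by
    have hψ : ∀ r : Rbase K Option.none, ∃ c : K, algebraMap K (Oord K f Option.none ⧸ P) c =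
        Ideal.Quotient.mk P (algebraMap _ (Oord K f Option.none) r) := by
      rintro ⟨r, hr⟩
      induction hr using Algebra.adjoin_induction with
      | mem r hr =>
        refine ⟨0, ?_⟩
        rw [map_zero, eq_comm, Ideal.Quotient.eq_zero_iff_mem]
        rw [Set.mem_singleton_iff] at hr
        subst hr
        exact hP
      | algebraMap c => exact ⟨c, rfl⟩
      | add r r' hr hr' ih ih' =>
        obtain ⟨c, hc⟩ := ih
        obtain ⟨c', hc'⟩ := ih'
        exact ⟨c + c', by rw [map_add, hc, hc', ← map_add, ← map_add]; rfl⟩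
      | mul r r' hr hr' ih ih' =>
        obtain ⟨c, hc⟩ := ih
        obtain ⟨c', hc'⟩ := ih'
        exact ⟨c * c', by rw [map_mul, hc, hc', ← map_mul, ← map_mul]; rfl⟩
    refine ⟨fun x => ?_⟩
    obtain ⟨x, rfl⟩ := Ideal.Quotient.mk_surjective x
    obtain ⟨r, hr, hrx⟩ := integralClosure.isIntegral (R := Rbase K Option.none) x
    let ψ := (Ideal.Quotient.mk P).comp (algebraMap (Rbase K Option.none) (Oord K f Option.none))
    obtain ⟨r', hr', -, hr'm⟩ := lifts_and_natDegree_eq_and_monic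
      (f := algebraMap K (Oord K f Option.none ⧸ P)) (p := r.map ψ)
      ((lifts_iff_coeff_lifts _).2 fun i => by
        obtain ⟨c, hc⟩ := hψ (r.coeff i)
        exact ⟨c, by rw [hc, coeff_map]; rfl⟩) (hr.map ψ)
    refine ⟨r', hr'm, ?_⟩
    rw [← eval_map, hr', eval_map, ← hom_eval₂]
    exact (congrArg _ hrx).trans (map_zero _)
  let q := ringExpChar K
  have : ExpChar (Oord K f Option.none ⧸ P) q :=
    expChar_of_injective_algebraMap (FaithfulSMul.algebraMap_injective K _) q
  intro x
  refine ⟨(τ • x).2, ?_⟩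
  change τ • x - x ∈ P
  obtain ⟨n, c, hc⟩ := IsPurelyInseparable.pow_mem K q (Ideal.Quotient.mk P x)
  have h1 : x ^ q ^ n - algebraMap K (Oord K f Option.none) c ∈ P := by
    rw [← Ideal.Quotient.eq, map_pow, ← hc]
    rfl
  have h2 := hτ _ h1
  rw [smul_sub, smul_pow'] at h2
  have h3 : τ • algebraMap K (Oord K f Option.none) c = algebraMap K (Oord K f Option.none) c := by
    refine Subtype.ext ?_
    exact AlgEquiv.commutes τ (algebraMap K (Fr K) c)
  rw [h3] at h2
  have h4 := P.sub_mem h2 h1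
  rw [sub_sub_sub_cancel_right, ← Ideal.Quotient.eq_zero_iff_mem, map_sub, map_pow, map_pow] at h4
  have h5 := sub_pow_expChar_pow (Ideal.Quotient.mk P (τ • x)) (Ideal.Quotient.mk P x) n (p := q)
  rw [← Ideal.Quotient.eq_zero_iff_mem, map_sub]
  exact eq_zero_of_pow_eq_zero (h5.trans h4)

open scoped Pointwise in
/-- The inertia group of a prime at infinity acts transitively on every level of the tree. -/
theorem exists_mem_inertiaSet_apply_eq [IsSepClosed K] (hf : (f.natDegree : K) ≠ 0)
    {P : Ideal (Oord K f Option.none)} (hP : IsPrimeOver K f Option.none P) {n : ℕ}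
    {s s' : Kinf K f} (hs : s ∈ preimK K f n) (hs' : s' ∈ preimK K f n) :
    ∃ τ ∈ inertiaSet K f Option.none P, τ s = s' := by
  have := hP.1
  have hu := hP.algebraMap_uInf_mem
  obtain ⟨σ, hσ⟩ := exists_gal_apply_eq hf hs hs'
  let E := IntermediateField.adjoin (Fr K) {s}
  let H := E.fixingSubgroup
  let : TopologicalSpace (Oord K f Option.none) := ⊥
  have : DiscreteTopology (Oord K f Option.none) := ⟨rfl⟩
  have : FiniteDimensional (Fr K) E :=
    IntermediateField.adjoin.finiteDimensional (Algebra.IsIntegral.isIntegral s)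
  have : CompactSpace H := isCompact_iff_compactSpace.1 E.fixingSubgroup_isClosed.isCompact
  have : ContinuousSMul H (Oord K f Option.none) := by
    refine continuousSMul_iff_stabilizer_isOpen.2 fun x => ?_
    convert (stabilizer_isOpen_of_isIntegral (K := Fr K) (x : Kinf K f)).preimage
      (continuous_subtype_val (p := fun σ : Gal K f => σ ∈ H)) using 1
    ext h
    exact Subtype.ext_iff
  let A := FixedPoints.subring (Oord K f Option.none) H
  have : Algebra.IsInvariant A (Oord K f Option.none) H := ⟨fun b hb => ⟨⟨b, hb⟩, rfl⟩⟩
  have huσ : algebraMap _ (Oord K f Option.none) (uInf K) ∈ σ⁻¹ • P := by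
    rw [Ideal.mem_inv_pointwise_smul_iff]
    convert hu using 1
    exact Subtype.ext (AlgEquiv.commutes σ _)
  obtain ⟨h, hh⟩ := Algebra.IsInvariant.exists_smul_of_under_eq_of_profinite (A := A) (G := H)
    P (σ⁻¹ • P) (by
      ext ⟨y, hy⟩
      refine mem_prime_iff_mem_prime hu huσ (s := s) (p := iter K f n) ?_ ?_
      · rw [← (mem_preimK_iff K f n s).1 hs, aeval_map_algebraMap]
      · change _ ∈ E
        rw [← InfiniteGalois.fixedField_fixingSubgroup E]
        exact fun g => congrArg Subtype.val (hy g))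
  refine ⟨σ * h, mem_inertiaSet_of_stabilizes hP.1 hu fun x hx => ?_, ?_⟩
  · have h1 : (h : Gal K f) • x ∈ (h : Gal K f) • P := Ideal.smul_mem_pointwise_smul _ _ _ hx
    have h2 : (h : Gal K f) • P = σ⁻¹ • P := hh.symm
    rw [h2, Ideal.mem_inv_pointwise_smul_iff] at h1
    rwa [mul_smul]
  · rw [AlgEquiv.mul_apply, ← hσ]
    exact congrArg σ (h.2 ⟨s, IntermediateField.mem_adjoin_simple_self _ s⟩)

end Place

section Inertia

variable {K : Type} [Field K] {f : K[X]}

theorem natDegree_cast_ne_zero (hd : 2 ≤ f.natDegree) (htame : TameAll K f) :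
    (f.natDegree : K) ≠ 0 := by
  intro h
  have hdvd := (ringChar.spec K f.natDegree).1 h
  rcases htame with h0 | h0
  · rw [h0, zero_dvd_iff] at hdvd
    omega
  · exact h0 Option.none hdvd

theorem none_mem_postCrit (hd : 2 ≤ f.natDegree) : Option.none ∈ PostCrit K f :=
  ⟨1, le_rfl, Option.none, hd, rfl⟩

theorem isOpen_setOf_apply_eq (s s' : Kinf K f) : IsOpen {σ : Gal K f | σ s = s'} := by
  refine isOpen_iff_forall_mem_open.2 fun τ hτ => ?_
  refine ⟨(fun σ => τ⁻¹ * σ) ⁻¹' (MulAction.stabilizer (Gal K f) s : Set (Gal K f)), ?_,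
    (stabilizer_isOpen_of_isIntegral (K := Fr K) s).preimage (continuous_const_mul _), ?_⟩
  · intro σ hσ
    have h : τ⁻¹ (σ s) = s := hσ
    have h' : (τ * τ⁻¹) (σ s) = τ s := congrArg τ h
    rw [mul_inv_cancel] at h'
    exact h'.trans hτ
  · simp

theorem exists_zpow_apply_eq [IsSepClosed K] (hd : 2 ≤ f.natDegree)
    (hf : (f.natDegree : K) ≠ 0) {g : P1 K → Gal K f} (hg : InertiaGenFamily K f g)
    {n : ℕ} {s s' : Kinf K f} (hs : s ∈ preimK K f n) (hs' : s' ∈ preimK K f n) :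
    ∃ m : ℤ, (g Option.none ^ m) s = s' := by
  obtain ⟨P, hP, hcl⟩ := hg.1 Option.none (none_mem_postCrit hd)
  obtain ⟨τ, hτ, hτs⟩ := exists_mem_inertiaSet_apply_eq hf hP hs hs'
  rw [← hcl] at hτ
  obtain ⟨_, hσ, m, rfl⟩ := mem_closure_iff.1 hτ _ (isOpen_setOf_apply_eq s s') hτs
  exact ⟨m, hσ⟩

end Inertia

section Odometer

variable {K : Type} [Field K] {f : K[X]} {g : Gal K f}

/-- `g` generates a group acting transitively on every level of the tree of preimages. -/
def LevelTransitive (g : Gal K f) : Prop :=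
  ∀ n : ℕ, ∀ s ∈ preimK K f n, ∀ s' ∈ preimK K f n, ∃ m : ℤ, (g ^ m) s = s'

theorem LevelTransitive.zpow_apply_eq_iff (hg : LevelTransitive g) (hf : (f.natDegree : K) ≠ 0)
    {n : ℕ} {s : Kinf K f} (hs : s ∈ preimK K f n) (m : ℤ) :
    (g ^ m) s = s ↔ ((f.natDegree ^ n : ℕ) : ℤ) ∣ m := by
  have horb : MulAction.orbit (Subgroup.zpowers g) s = preimK K f n := by
    ext s'
    constructor
    · rintro ⟨⟨_, m, rfl⟩, rfl⟩
      exact apply_mem_preimK (g ^ m) hs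
    · intro hs'
      obtain ⟨m, hm⟩ := hg n s hs s' hs'
      exact ⟨⟨g ^ m, m, rfl⟩, hm⟩
  have hfin : Fintype (MulAction.orbit (Subgroup.zpowers g) s) :=
    (horb ▸ finite_preimK hf n : (MulAction.orbit (Subgroup.zpowers g) s).Finite).fintype
  have hcard : Function.minimalPeriod (g • ·) s = f.natDegree ^ n := by
    rw [MulAction.minimalPeriod_eq_card (a := g) (b := s), ← Nat.card_eq_fintype_card, Nat.card_coe_set_eq, horb,
      ncard_preimK hf]
  rw [← hcard]
  exact MulAction.zpow_smul_eq_iff_minimalPeriod_dvd (a := g) (b := s)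

theorem LevelTransitive.pow_apply_eq_iff (hg : LevelTransitive g) (hf : (f.natDegree : K) ≠ 0)
    {n : ℕ} {s : Kinf K f} (hs : s ∈ preimK K f n) (m : ℕ) :
    (g ^ m) s = s ↔ f.natDegree ^ n ∣ m := by
  rw [← zpow_natCast, hg.zpow_apply_eq_iff hf hs, Int.natCast_dvd_natCast]

theorem aeval_fF_apply (σ : Gal K f) (s : Kinf K f) :
    aeval (σ s) (fF K f) = σ (aeval s (fF K f)) := by
  rw [← AlgEquiv.coe_toAlgHom, aeval_algHom_apply]

/-- The power of `g` fixing a level acts simply transitively on the descendants of each vertex of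
that level. -/
theorem LevelTransitive.existsUnique_pow (hg : LevelTransitive g) (hf : (f.natDegree : K) ≠ 0)
    {n : ℕ} {s₁ s₂ : Kinf K f} (h₁ : s₁ ∈ preimK K f (n + 1)) (h₂ : s₂ ∈ preimK K f (n + 1))
    (h : aeval s₁ (fF K f) = aeval s₂ (fF K f)) :
    ∃! k, k < f.natDegree ∧ ((g ^ f.natDegree ^ n) ^ k) s₁ = s₂ := by
  have hd : 0 < f.natDegree := Nat.pos_of_ne_zero fun h => hf (by simp [h])
  have hpos : 0 < f.natDegree ^ n := pow_pos hd n
  obtain ⟨m, hm⟩ := hg _ _ h₁ _ h₂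
  have hdvd : ((f.natDegree ^ n : ℕ) : ℤ) ∣ m := by
    rw [← hg.zpow_apply_eq_iff hf ((mem_preimK_succ_iff K f n s₁).1 h₁), ← aeval_fF_apply, hm, h]
  obtain ⟨j, rfl⟩ := hdvd
  have hiff (k : ℕ) : ((g ^ f.natDegree ^ n) ^ k) s₁ = s₂ ↔ (f.natDegree : ℤ) ∣ j - k := by
    rw [← hm, ← pow_mul, ← zpow_natCast, eq_comm]
    have h1 : (g ^ (((f.natDegree ^ n : ℕ) : ℤ) * j)) s₁ =
        (g ^ ((f.natDegree ^ n * k : ℕ) : ℤ)) s₁ ↔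
        (g ^ (((f.natDegree ^ n : ℕ) : ℤ) * (j - k))) s₁ = s₁ := by
      rw [show ((f.natDegree ^ n : ℕ) : ℤ) * (j - k) =
        -((f.natDegree ^ n * k : ℕ) : ℤ) + ((f.natDegree ^ n : ℕ) : ℤ) * j by push_cast; ring,
        zpow_add, zpow_neg, AlgEquiv.mul_apply]
      exact (AlgEquiv.symm_apply_eq _).symm
    rw [h1, hg.zpow_apply_eq_iff hf h₁, pow_succ, Nat.cast_mul]
    exact mul_dvd_mul_iff_left (by exact_mod_cast hpos.ne')
  simp only [hiff]
  have hd' : (0 : ℤ) < f.natDegree := by exact_mod_cast hd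
  refine ⟨(j % f.natDegree).toNat, ⟨?_, ?_⟩, ?_⟩
  · have := Int.emod_lt_of_pos j hd'
    have := Int.emod_nonneg j hd'.ne'
    omega
  · rw [Int.toNat_of_nonneg (Int.emod_nonneg j hd'.ne')]
    exact Int.dvd_self_sub_emod
  · rintro k ⟨hk, hk'⟩
    have h2 : (k : ℤ) % f.natDegree = j % f.natDegree := Int.modEq_iff_dvd.2 hk'
    rw [← h2, Int.emod_eq_of_lt (by positivity) (by exact_mod_cast hk), Int.toNat_natCast]

open scoped Classical in
theorem xfixGal_eq_sum (hf : (f.natDegree : K) ≠ 0) (n : ℕ) (σ : Gal K f) :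
    XfixGal K f n σ = ∑ s ∈ (finite_preimK hf n).toFinset, if σ s = s then 1 else 0 := by
  rw [← Finset.card_filter, XfixGal, ← Set.ncard_coe_finset]
  congr 1
  ext s
  simp

theorem LevelTransitive.exists_child (hg : LevelTransitive g) (hf : (f.natDegree : K) ≠ 0)
    {n : ℕ} {v : Kinf K f} (hv : v ∈ preimK K f n) :
    ∃ w ∈ preimK K f (n + 1), aeval w (fF K f) = v := by
  have hd : 0 < f.natDegree := Nat.pos_of_ne_zero fun h => hf (by simp [h])
  obtain ⟨x, hx⟩ : (preimK K f (n + 1)).Nonempty :=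
    Set.nonempty_of_ncard_ne_zero (ncard_preimK hf (n + 1) ▸ (pow_pos hd _).ne')
  obtain ⟨m, hm⟩ := hg n _ ((mem_preimK_succ_iff K f n x).1 hx) v hv
  exact ⟨(g ^ m) x, apply_mem_preimK _ hx, (aeval_fF_apply _ _).trans hm⟩

open scoped Classical in
theorem LevelTransitive.card_children (hg : LevelTransitive g) (hf : (f.natDegree : K) ≠ 0)
    {n : ℕ} {v : Kinf K f} (hv : v ∈ preimK K f n) :
    {w ∈ (finite_preimK hf (n + 1)).toFinset | aeval w (fF K f) = v}.card = f.natDegree := by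
  obtain ⟨x, hx, hxv⟩ := hg.exists_child hf hv
  have hfix (k : ℕ) : ((g ^ f.natDegree ^ n) ^ k) v = v := by
    rw [← pow_mul, hg.pow_apply_eq_iff hf hv]
    exact dvd_mul_right _ _
  have hmem (k : ℕ) : ((g ^ f.natDegree ^ n) ^ k) x ∈ preimK K f (n + 1) ∧
      aeval (((g ^ f.natDegree ^ n) ^ k) x) (fF K f) = v :=
    ⟨apply_mem_preimK _ hx, by rw [aeval_fF_apply, hxv, hfix]⟩
  conv_rhs => rw [← Finset.card_range f.natDegree]
  symm
  refine Finset.card_bij (fun k _ => ((g ^ f.natDegree ^ n) ^ k) x) (fun k _ => ?_)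
    (fun k hk l hl hkl => ?_) fun w hw => ?_
  · simpa using hmem k
  · refine (hg.existsUnique_pow hf hx (hmem l).1 (hxv.trans (hmem l).2.symm)).unique
      ⟨Finset.mem_range.1 hk, hkl⟩ ⟨Finset.mem_range.1 hl, rfl⟩
  · simp only [Finset.mem_filter, Set.Finite.mem_toFinset] at hw
    obtain ⟨k, hk, hkw⟩ := (hg.existsUnique_pow hf hx hw.1 (hxv.trans hw.2.symm)).exists
    exact ⟨k, Finset.mem_range.2 hk, hkw⟩

/-- Averaging the number of fixed vertices of level `n + 1` over the powers of `g` fixing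
level `n`. -/
theorem LevelTransitive.sum_xfixGal (hg : LevelTransitive g) (hf : (f.natDegree : K) ≠ 0)
    (n : ℕ) (σ : Gal K f) :
    ∑ k ∈ Finset.range f.natDegree, XfixGal K f (n + 1) ((g ^ f.natDegree ^ n) ^ k * σ) =
      f.natDegree * XfixGal K f n σ := by
  classical
  have hfix {v : Kinf K f} (hv : v ∈ preimK K f n) (k : ℕ) :
      ((g ^ f.natDegree ^ n) ^ k) v = v := by
    rw [← pow_mul, hg.pow_apply_eq_iff hf hv]
    exact dvd_mul_right _ _
  have hpar {w : Kinf K f} (hw : w ∈ preimK K f (n + 1)) :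
      (∑ k ∈ Finset.range f.natDegree,
        if ((g ^ f.natDegree ^ n) ^ k * σ) w = w then 1 else 0) =
      if σ (aeval w (fF K f)) = aeval w (fF K f) then 1 else 0 := by
    rw [← Finset.card_filter]
    split_ifs with h
    · have hw' := apply_mem_preimK σ hw
      obtain ⟨k, hk, huniq⟩ := hg.existsUnique_pow hf hw' hw ((aeval_fF_apply σ w).trans h)
      refine Finset.card_eq_one.2 ⟨k, ?_⟩
      ext l
      simp only [Finset.mem_filter, Finset.mem_range, Finset.mem_singleton]
      exact ⟨fun hl => huniq l hl, fun hl => hl ▸ hk⟩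
    · refine Finset.card_eq_zero.2 (Finset.filter_eq_empty_iff.2 fun k _ hk => h ?_)
      have hp := (mem_preimK_succ_iff K f n w).1 hw
      rw [← hfix (apply_mem_preimK σ hp) k, ← AlgEquiv.mul_apply, ← aeval_fF_apply, hk]
  simp only [xfixGal_eq_sum hf]
  rw [Finset.sum_comm, Finset.sum_congr rfl fun w hw => hpar (by simpa using hw),
    ← Finset.sum_fiberwise_of_maps_to (t := (finite_preimK hf n).toFinset)
      (g := fun w => aeval w (fF K f))
      (fun w hw => by simpa [← mem_preimK_succ_iff] using hw), Finset.mul_sum]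
  refine Finset.sum_congr rfl fun v hv => ?_
  rw [Finset.sum_congr rfl fun w hw => by rw [(Finset.mem_filter.1 hw).2], Finset.sum_const,
    hg.card_children hf (by simpa using hv), smul_eq_mul]

end Odometer

section FixedPointCount

variable {K : Type} [Field K] {f : K[X]} {g : Gal K f}

instance : BorelSpace (Gal K f) := ⟨rfl⟩

theorem measurable_xfixGal (hf : (f.natDegree : K) ≠ 0) (n : ℕ) :
    Measurable (XfixGal K f n) := by
  classical
  simp only [funext (xfixGal_eq_sum hf n)]
  exact Finset.measurable_sum _ fun s _ =>
    Measurable.ite (isOpen_setOf_apply_eq s s).measurableSet measurable_const measurable_const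

theorem integrable_xfixGal (hf : (f.natDegree : K) ≠ 0) (n : ℕ) (μ : Measure (Gal K f))
    [IsFiniteMeasure μ] : Integrable (fun σ : Gal K f => (XfixGal K f n σ : ℝ)) μ := by
  refine Integrable.of_bound
    (measurable_from_top.comp (measurable_xfixGal hf n)).aestronglyMeasurable
    ((f.natDegree ^ n : ℕ) : ℝ) (.of_forall fun σ => ?_)
  rw [Real.norm_natCast, Nat.cast_le, ← ncard_preimK hf n]
  exact Set.ncard_le_ncard (Set.sep_subset _ _) (finite_preimK hf n)

theorem LevelTransitive.xfixGal_mul (hg : LevelTransitive g) (hf : (f.natDegree : K) ≠ 0)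
    {i n : ℕ} (hi : i ≤ n) (k : ℕ) (σ : Gal K f) :
    XfixGal K f i ((g ^ f.natDegree ^ n) ^ k * σ) = XfixGal K f i σ := by
  refine congrArg Set.ncard (Set.sep_ext_iff.2 fun s hs => ?_)
  have h : ((g ^ f.natDegree ^ n) ^ k) (σ s) = σ s := by
    rw [← pow_mul, hg.pow_apply_eq_iff hf (apply_mem_preimK σ hs)]
    exact (pow_dvd_pow _ hi).mul_right k
  rw [AlgEquiv.mul_apply, h]

theorem LevelTransitive.fpMartingaleGal (hg : LevelTransitive g) (hf : (f.natDegree : K) ≠ 0)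
    (μ : Measure (Gal K f)) [IsFiniteMeasure μ] [μ.IsMulLeftInvariant] :
    FPMartingaleGal K f μ := by
  refine ⟨fun n _ => integrable_xfixGal hf n μ, fun n hn t _ => ?_⟩
  set A := {σ : Gal K f | ∀ i, 1 ≤ i → i ≤ n → (XfixGal K f i σ : ℝ) = t i} with hA
  have hAmeas : MeasurableSet A := by
    rw [hA]
    simp only [Set.ofPred_forall]
    refine MeasurableSet.iInter fun i => MeasurableSet.iInter fun _ => MeasurableSet.iInter fun _ =>
      ?_
    exact (measurable_from_top.comp (measurable_xfixGal hf i)) (measurableSet_singleton (t i))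
  have hinv (k : ℕ) : ∫ σ in A, (XfixGal K f (n + 1) ((g ^ f.natDegree ^ n) ^ k * σ) : ℝ) ∂μ =
      ∫ σ in A, (XfixGal K f (n + 1) σ : ℝ) ∂μ := by
    rw [← integral_indicator hAmeas, ← integral_indicator hAmeas,
      ← integral_mul_left_eq_self (A.indicator fun σ => (XfixGal K f (n + 1) σ : ℝ))
        ((g ^ f.natDegree ^ n) ^ k)]
    refine integral_congr_ae (.of_forall fun σ => ?_)
    have hmem : (g ^ f.natDegree ^ n) ^ k * σ ∈ A ↔ σ ∈ A :=
      forall_congr' fun i => forall_congr' fun _ => forall_congr' fun hi => by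
        rw [hg.xfixGal_mul hf hi]
    simp only [Set.indicator, hmem]
  have hd : (f.natDegree : ℝ) ≠ 0 := Nat.cast_ne_zero.2 fun h => hf (by simp [h])
  refine mul_left_cancel₀ hd ?_
  calc (f.natDegree : ℝ) * ∫ σ in A, (XfixGal K f (n + 1) σ : ℝ) ∂μ
      = ∑ k ∈ Finset.range f.natDegree,
          ∫ σ in A, (XfixGal K f (n + 1) ((g ^ f.natDegree ^ n) ^ k * σ) : ℝ) ∂μ := by
        simp [hinv]
    _ = ∫ σ in A, ∑ k ∈ Finset.range f.natDegree,
          (XfixGal K f (n + 1) ((g ^ f.natDegree ^ n) ^ k * σ) : ℝ) ∂μ :=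
        (integral_finsetSum _ fun k _ =>
          ((integrable_xfixGal hf (n + 1) μ).comp_mul_left _).integrableOn).symm
    _ = ∫ _ in A, (f.natDegree : ℝ) * t n ∂μ := by
        refine setIntegral_congr_fun hAmeas fun σ hσ => ?_
        have h := congrArg (Nat.cast : ℕ → ℝ) (hg.sum_xfixGal hf n σ)
        push_cast at h
        exact h.trans (by rw [hσ n hn le_rfl])
    _ = f.natDegree * (t n * (μ A).toReal) := by
        rw [setIntegral_const, smul_eq_mul, Measure.real]
        ring

end FixedPointCount

/-- Let `K` be a separably closed field and `f ∈ K[x]` a polynomial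
of degree `d ≥ 2` (tame case), `G := G_∞(K,f,t)` and `g_∞` the inertia topological
generator at the totally ramified fixed point `∞`.  Then (i) `g_∞^{d^n}` fixes
`f^{-n}(t)` pointwise, and on the immediate descendants of each level-`n` vertex its
powers act transitively (i.e. its first-level restriction at each level-`n` vertex is
a `d`-cycle); and (ii) the fixed-point process of `G` is a martingale. -/
theorem monodromy_at_infinity
    (K : Type) [Field K] [IsSepClosed K] (f : Polynomial K)
    (hd : 2 ≤ f.natDegree) (htame : TameAll K f)
    (g : P1 K → Gal K f) (hg : InertiaGenFamily K f g) :
    ((∀ n : ℕ, 1 ≤ n → ∀ s ∈ preimK K f n,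
        ((g Option.none) ^ f.natDegree ^ n) s = s) ∧
     (∀ n : ℕ, 1 ≤ n → ∀ s ∈ preimK K f n,
        ∀ s₁ ∈ preimK K f (n + 1), ∀ s₂ ∈ preimK K f (n + 1),
          Polynomial.aeval s₁ (fF K f) = s → Polynomial.aeval s₂ (fF K f) = s →
            ∃ k : ℕ, (((g Option.none) ^ f.natDegree ^ n) ^ k) s₁ = s₂)) ∧
    (∀ μ : Measure (Gal K f), IsProbabilityMeasure μ → μ.IsMulLeftInvariant →
        FPMartingaleGal K f μ) := by
  have hf := natDegree_cast_ne_zero hd htame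
  have hlt : LevelTransitive (g Option.none) := fun _ _ hs _ hs' =>
    exists_zpow_apply_eq hd hf hg hs hs'
  refine ⟨⟨fun n _ s hs => (hlt.pow_apply_eq_iff hf hs _).2 dvd_rfl,
    fun n _ s _ s₁ h₁ s₂ h₂ hs₁ hs₂ => ?_⟩, fun μ _ _ => hlt.fpMartingaleGal hf μ⟩
  obtain ⟨k, -, hk⟩ := (hlt.existsUnique_pow hf h₁ h₂ (hs₁.trans hs₂.symm)).exists
  exact ⟨k, hk⟩

end ArbGal
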